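/- Let C be a clone on {0,1,2} such that every operation in C is idempotent, C contains a Mal'cev operation, C contains no majority operation, and some operation in C does not preserve the relation φ = {(0,1),(1,2),(2,0)}. Then there exists i ∈ {0,1,2} such that the operation d_i belongs to C, where d_i(x,y,z) equals the minority value of x,y,z if at most two distinct values occur among x,y,z (i.e., d_i(x,y,y) = d_i(y,x,y) = d_i(y,y,x) = x), and d_i(x,y,z) = i if x,y,z are pairwise distinct. -/

import Mathlib

/-- `f` preserves the `k`-ary relation `R`. -/
def Preserves {A : Type} {n k : ℕ} (f : (Fin n → A) → A) (R : Set (Fin k → A)) : Prop :=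
  ∀ r : Fin n → Fin k → A, (∀ i, r i ∈ R) → (fun j => f fun i => r i j) ∈ R

/-- A family of operations on `A`, indexed so that `C n` are the `(n+1)`-ary operations. -/
abbrev Ops (A : Type) := ∀ n : ℕ, Set ((Fin (n + 1) → A) → A)

/-- `C` is a clone: it contains all projections and is closed under composition. -/
structure IsClone {A : Type} (C : Ops A) : Prop where
  proj : ∀ (n : ℕ) (i : Fin (n + 1)), (fun x => x i) ∈ C n
  comp : ∀ (n m : ℕ) (f : (Fin (n + 1) → A) → A) (g : Fin (n + 1) → (Fin (m + 1) → A) → A),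
      f ∈ C n → (∀ i, g i ∈ C m) → (fun x => f fun i => g i x) ∈ C m

/-- A subset of `A` viewed as a unary relation. -/
def unRel {A : Type} (s : Set A) : Set (Fin 1 → A) := {t | t 0 ∈ s}

def psi2 : Set (Fin 2 → Fin 3) :=
  {t | (t 0, t 1) ∈ ({(0, 1), (1, 0), (2, 2)} : Set (Fin 3 × Fin 3))}

def psi2' : Set (Fin 2 → Fin 3) :=
  {t | (t 0, t 1) ∈ ({(0, 1), (1, 0)} : Set (Fin 3 × Fin 3))}

def phi : Set (Fin 2 → Fin 3) :=
  {t | (t 0, t 1) ∈ ({(0, 1), (1, 2), (2, 0)} : Set (Fin 3 × Fin 3))}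

def mu2 : Set (Fin 2 → Fin 3) :=
  {t | (t 0, t 1) ∈ ({(0, 0), (1, 1), (2, 2), (0, 1), (1, 0)} : Set (Fin 3 × Fin 3))}

def rho2 : Set (Fin 2 → Fin 3) :=
  {t | (t 0, t 1) ∈ ({(0, 2), (1, 2), (2, 0), (2, 1)} : Set (Fin 3 × Fin 3))}

/-- The minority value of `x, y, z` when at most two distinct values occur
(and `x` if all three are distinct). -/
def mino {A : Type} [DecidableEq A] (x y z : A) : A :=
  if x = y then z else if x = z then y else x

/-- The relation `T_i' = {(x,y,z,min(x,y,z)) : x,y,z ≠ i}`. -/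
def Tprime (i : Fin 3) : Set (Fin 4 → Fin 3) :=
  {t | t 0 ≠ i ∧ t 1 ≠ i ∧ t 2 ≠ i ∧ t 3 = mino (t 0) (t 1) (t 2)}

/-- The relation `T₂ = T₂' ∪ {(2,2,2,2)}`. -/
def T2rel : Set (Fin 4 → Fin 3) := insert (fun _ => 2) (Tprime 2)

/-- The relation `T = {(x,y,z,x-y+z mod 3)}`. -/
def Trel : Set (Fin 4 → Fin 3) := {t | t 3 = t 0 - t 1 + t 2}

/-- The operation `d_i`: minority on triples with at most two distinct values, and
constant value `i` on triples of pairwise distinct values. -/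
def dOp (i : Fin 3) : (Fin 3 → Fin 3) → Fin 3 := fun x =>
  if x 0 ≠ x 1 ∧ x 0 ≠ x 2 ∧ x 1 ≠ x 2 then i else mino (x 0) (x 1) (x 2)

/-! ### Terms in one ternary operation symbol, and a branching checker -/

/-- Terms in three variables over one ternary operation symbol. -/
inductive Tm where
  | x : Tm
  | y : Tm
  | z : Tm
  | ap : Tm → Tm → Tm → Tm

/-- Evaluation of a term. -/
def Tm.eval {α : Type} (f : α → α → α → α) (a b c : α) : Tm → α
  | .x => a
  | .y => b
  | .z => c
  | .ap p q r => f (p.eval f a b c) (q.eval f a b c) (r.eval f a b c)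

/-- Substitution of terms for the variables. -/
def Tm.sub (s u v w : Tm) : Tm :=
  match s with
  | .x => u
  | .y => v
  | .z => w
  | .ap p q r => .ap (p.sub u v w) (q.sub u v w) (r.sub u v w)

/-- Substitution of the term `t` for the operation symbol. -/
def Tm.subOp (s t : Tm) : Tm :=
  match s with
  | .x => .x
  | .y => .y
  | .z => .z
  | .ap p q r => t.sub (p.subOp t) (q.subOp t) (r.subOp t)

theorem Tm.eval_sub {α : Type} (f : α → α → α → α) (a b c : α) (u v w t : Tm) :
    (t.sub u v w).eval f a b c
      = t.eval f (u.eval f a b c) (v.eval f a b c) (w.eval f a b c) := by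
  induction t with
  | x => rfl
  | y => rfl
  | z => rfl
  | ap p q r hp hq hr => simp [Tm.sub, Tm.eval, hp, hq, hr]

theorem Tm.eval_subOp {α : Type} (f : α → α → α → α) (a b c : α) (t s : Tm) :
    (s.subOp t).eval f a b c = s.eval (fun x y z => t.eval f x y z) a b c := by
  induction s with
  | x => rfl
  | y => rfl
  | z => rfl
  | ap p q r hp hq hr => simp [Tm.subOp, Tm.eval, Tm.eval_sub, hp, hq, hr]

/-- A three element type that reduces fast. -/
inductive V where
  | e0 : V
  | e1 : V
  | e2 : V

/-- Case distinction. -/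
noncomputable def V.sw {α : Type} (u : V) (p q r : α) : α := V.rec (motive := fun _ => α) p q r u

/-- Equality test. -/
noncomputable def V.eqb (u v : V) : Bool :=
  u.sw (v.sw true false false) (v.sw false true false) (v.sw false false true)

theorem V.eqb_iff (u v : V) : u.eqb v = true ↔ u = v := by
  cases u <;> cases v <;> simp [V.eqb, V.sw]

/-- A partial value. -/
inductive E where
  | no : E
  | v : V → E

/-- Triples. -/
inductive Tri (α : Type) where
  | mk : α → α → α → Tri α

/-- Partial tables. -/
abbrev Tab := Tri (Tri (Tri E))

noncomputable def Tri.get {α : Type} (t : Tri α) (u : V) : α :=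
  Tri.rec (motive := fun _ => α) (fun p q r => u.sw p q r) t

/-- Strict update. -/
noncomputable def Tri.setK {α β : Type} (t : Tri α) (u : V) (n : α) (k : Tri α → β) : β :=
  Tri.rec (motive := fun _ => β)
    (fun p q r => u.sw (k (.mk n q r)) (k (.mk p n r)) (k (.mk p q n))) t

noncomputable def Tab.look (t : Tab) (u v w : V) : E := Tri.get (Tri.get (Tri.get t u) v) w

noncomputable def Tab.setK {β : Type} (t : Tab) (u v w : V) (n : E) (k : Tab → β) : β :=
  Tri.setK (Tri.get (Tri.get t u) v) w n fun t2 =>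
    Tri.setK (Tri.get t u) v t2 fun t1 => Tri.setK t u t1 k

/-- The updated table. -/
noncomputable def Tab.set (t : Tab) (u v w : V) (n : E) : Tab := Tab.setK t u v w n id

theorem Tri.setK_eq {α β : Type} (t : Tri α) (u : V) (n : α) (k : Tri α → β) :
    Tri.setK t u n k = k (Tri.setK t u n id) := by
  cases t; cases u <;> rfl

open Classical in
theorem Tri.get_setK {α : Type} (t : Tri α) (u v : V) (n : α) :
    Tri.get (Tri.setK t u n id) v = if u = v then n else Tri.get t v := by
  cases t; cases u <;> cases v <;> simp [Tri.get, Tri.setK, V.sw]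

theorem Tab.setK_eq {β : Type} (t : Tab) (u v w : V) (n : E) (k : Tab → β) :
    Tab.setK t u v w n k = k (Tab.set t u v w n) := by
  simp only [Tab.set, Tab.setK]
  rw [Tri.setK_eq, Tri.setK_eq (k := fun t1 => Tri.setK t u t1 k), Tri.setK_eq (k := k)]
  rw [Tri.setK_eq (Tri.get (Tri.get t u) v)
    (k := fun t2 => (Tri.get t u).setK v t2 fun t1 => Tri.setK t u t1 id),
    Tri.setK_eq (Tri.get t u) (k := fun t1 => Tri.setK t u t1 id)]

open Classical in
theorem Tab.look_set (t : Tab) (u v w u' v' w' : V) (n : E) :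
    Tab.look (Tab.set t u v w n) u' v' w'
      = if u = u' ∧ v = v' ∧ w = w' then n else Tab.look t u' v' w' := by
  simp only [Tab.set, Tab.setK]
  rw [Tri.setK_eq (Tri.get (Tri.get t u) v)
    (k := fun t2 => (Tri.get t u).setK v t2 fun t1 => Tri.setK t u t1 id),
    Tri.setK_eq (Tri.get t u) (k := fun t1 => Tri.setK t u t1 id)]
  simp only [Tab.look, Tri.get_setK]
  by_cases h1 : u = u'
  · by_cases h2 : v = v'
    · by_cases h3 : w = w' <;> simp [h1, h2, h3, Tri.get_setK]
    · simp [h1, h2, Tri.get_setK]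
  · simp [h1]

/-- Results of a computation in a partial table. -/
inductive Res where
  | v : V → Res
  | need : V → V → V → Res

noncomputable def Res.sw {α : Type} (r : Res) (f : V → α) (g : V → V → V → α) : α :=
  Res.rec (motive := fun _ => α) f g r

/-- Evaluate the continuation at the value, with the value inspected first. -/
noncomputable def Res.bnd (r : Res) (f : V → Res) : Res :=
  r.sw (fun u => u.sw (f .e0) (f .e1) (f .e2)) .need

noncomputable def E.res (e : E) (u v w : V) : Res :=
  E.rec (motive := fun _ => Res) (.need u v w) .v e

/-- Evaluation of a term in a partial table. -/
noncomputable def Tm.peval (t : Tab) (a b c : V) (s : Tm) : Res :=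
  Tm.rec (motive := fun _ => Res) (.v a) (.v b) (.v c)
    (fun _ _ _ p q r => p.bnd fun u => q.bnd fun v => r.bnd fun w => (Tab.look t u v w).res u v w) s

/-- Results of a test. -/
inductive TR where
  | ok : TR
  | und : TR
  | need : V → V → V → TR

noncomputable def TR.or (r s : TR) : TR := TR.rec (motive := fun _ => TR) .ok s .need r

noncomputable def Res.tst (r : Res) (f : V → TR) : TR :=
  r.sw (fun u => u.sw (f .e0) (f .e1) (f .e2)) .need

/-- Run a test, branching on the entries it asks for. -/
noncomputable def run (test : Tab → TR) (n : ℕ) : Tab → Bool :=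
  Nat.rec (motive := fun _ => Tab → Bool) (fun _ => false)
    (fun _ rec t => TR.rec (motive := fun _ => Bool) true false
      (fun u v w => Tab.setK t u v w (.v .e0) rec &&
        (Tab.setK t u v w (.v .e1) rec && Tab.setK t u v w (.v .e2) rec)) (test t)) n

/-- The partial table `t` agrees with the operation `M`. -/
def Compat (t : Tab) (M : V → V → V → V) : Prop :=
  ∀ u v w x, Tab.look t u v w = .v x → M u v w = x

theorem Res.bnd_v {r : Res} {f : V → Res} {x : V} (h : r.bnd f = .v x) :
    ∃ y, r = .v y ∧ f y = .v x := by
  cases r with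
  | v y => refine ⟨y, rfl, ?_⟩; cases y <;> exact h
  | need u v w => exact absurd h (by simp [Res.bnd, Res.sw])

theorem Res.tst_ok {r : Res} {f : V → TR} (h : r.tst f = .ok) :
    ∃ y, r = .v y ∧ f y = .ok := by
  cases r with
  | v y => refine ⟨y, rfl, ?_⟩; cases y <;> exact h
  | need u v w => exact absurd h (by simp [Res.tst, Res.sw])

theorem TR.or_ok {r s : TR} (h : r.or s = .ok) : r = .ok ∨ s = .ok := by
  cases r with
  | ok => exact Or.inl rfl
  | und => exact Or.inr h
  | need u v w => exact absurd h (by simp [TR.or])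

theorem Tm.peval_sound {t : Tab} {M : V → V → V → V} (hc : Compat t M) {a b c : V} (s : Tm)
    {x : V} (h : s.peval t a b c = .v x) : s.eval M a b c = x := by
  induction s generalizing x with
  | x => exact Res.v.inj h
  | y => exact Res.v.inj h
  | z => exact Res.v.inj h
  | ap p q r hp hq hr =>
    obtain ⟨u, h1, h⟩ := Res.bnd_v (f := fun u => (q.peval t a b c).bnd fun v =>
      (r.peval t a b c).bnd fun w => (Tab.look t u v w).res u v w) (r := p.peval t a b c) h
    obtain ⟨v, h2, h⟩ := Res.bnd_v h
    obtain ⟨w, h3, h⟩ := Res.bnd_v h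
    simp only [Tm.eval, hp h1, hq h2, hr h3]
    apply hc
    cases h4 : Tab.look t u v w with
    | no => simp [h4, E.res] at h
    | v y => simpa [h4, E.res] using h

theorem run_sound {test : Tab → TR} {M : V → V → V → V} {P : Prop}
    (ht : ∀ t, Compat t M → test t = .ok → P) :
    ∀ (n : ℕ) (t : Tab), Compat t M → run test n t = true → P := by
  intro n
  induction n with
  | zero => intro t _ h; simp [run] at h
  | succ n ih =>
    intro t hc h
    have h' : TR.rec (motive := fun _ => Bool) true false
      (fun u v w => Tab.setK t u v w (.v .e0) (run test n) &&
        (Tab.setK t u v w (.v .e1) (run test n) && Tab.setK t u v w (.v .e2) (run test n)))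
        (test t) = true := h
    clear h
    cases hk : test t with
    | ok => exact ht t hc hk
    | und => simp [hk] at h'
    | need u v w =>
      simp only [hk, Tab.setK_eq, Bool.and_eq_true] at h'
      obtain ⟨h0, h1, h2⟩ := h'
      have key : Compat (Tab.set t u v w (.v (M u v w))) M := by
        intro u' v' w' x hx
        rw [Tab.look_set] at hx
        split_ifs at hx with e
        · obtain ⟨rfl, rfl, rfl⟩ := e
          exact E.v.inj hx
        · exact hc _ _ _ _ hx
      generalize M u v w = y at key
      cases y
      · exact ih _ key h0
      · exact ih _ key h1
      · exact ih _ key h2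

/-- A test that the term `s` takes the value `e` at `a, b, c`; on success continue. -/
noncomputable def chkEq (t : Tab) (s : Tm) (a b c e : V) (k : TR) : TR :=
  (s.peval t a b c).tst fun v => Bool.rec (motive := fun _ => TR) .und k (v.eqb e)

theorem chkEq_ok {t : Tab} {M : V → V → V → V} (hc : Compat t M) {s : Tm} {a b c e : V}
    {k : TR} (h : chkEq t s a b c e k = .ok) : s.eval M a b c = e ∧ k = .ok := by
  obtain ⟨y, h1, h2⟩ := Res.tst_ok h
  rw [Tm.peval_sound hc s h1]
  cases hb : y.eqb e with
  | false => simp [hb] at h2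
  | true => exact ⟨(V.eqb_iff _ _).1 hb, by simpa [hb] using h2⟩

/-- Check that the term `s` takes given values at given points. -/
noncomputable def chkAll (t : Tab) (s : Tm) (e : V → V → V → V) (l : List (Tri V)) : TR :=
  List.rec (motive := fun _ => TR) .ok
    (fun q _ k => Tri.rec (motive := fun _ => TR) (fun a b c => chkEq t s a b c (e a b c) k) q) l

theorem chkAll_ok {t : Tab} {M : V → V → V → V} (hc : Compat t M) {s : Tm}
    {e : V → V → V → V} (l : List (Tri V)) (h : chkAll t s e l = .ok) :
    ∀ a b c, Tri.mk a b c ∈ l → s.eval M a b c = e a b c := by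
  induction l with
  | nil => simp
  | cons q l ih =>
    obtain ⟨a, b, c⟩ := q
    obtain ⟨h1, h2⟩ := chkEq_ok (k := chkAll t s e l) hc h
    intro a' b' c' hq
    rcases List.mem_cons.1 hq with hq | hq
    · injection hq with e1 e2 e3; subst e1 e2 e3; exact h1
    · exact ih h2 _ _ _ hq

/-- All triples, those with distinct entries first. -/
def allPts : List (Tri V) :=
  [.mk .e0 .e1 .e2, .mk .e0 .e2 .e1, .mk .e1 .e0 .e2, .mk .e1 .e2 .e0, .mk .e2 .e0 .e1, .mk .e2 .e1 .e0,
   .mk .e0 .e1 .e0, .mk .e0 .e2 .e0, .mk .e1 .e0 .e1, .mk .e1 .e2 .e1, .mk .e2 .e0 .e2, .mk .e2 .e1 .e2,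
   .mk .e0 .e0 .e1, .mk .e0 .e0 .e2, .mk .e1 .e1 .e0, .mk .e1 .e1 .e2, .mk .e2 .e2 .e0, .mk .e2 .e2 .e1,
   .mk .e1 .e0 .e0, .mk .e2 .e0 .e0, .mk .e0 .e1 .e1, .mk .e2 .e1 .e1, .mk .e0 .e2 .e2, .mk .e1 .e2 .e2,
   .mk .e0 .e0 .e0, .mk .e1 .e1 .e1, .mk .e2 .e2 .e2]

theorem mem_allPts (a b c : V) : Tri.mk a b c ∈ allPts := by
  cases a <;> cases b <;> cases c <;> simp [allPts]

/-! ### Stage A -/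

def tS : Tm := .ap (.ap .x .z .y) (.ap .y .z .y) .z
def tU : Tm := .ap .x (.ap .x (.ap .x .y .x) .y) (.ap .x (.ap .x .y .x) .z)

/-- The words that reverse bad pairs. -/
def wordsR : List Tm := [tS, tU.subOp tS, tS.subOp tU]

/-- The words that keep bad pairs. -/
def wordsK : List Tm := [tU, tS.subOp tS, tU.subOp tU]

/-- The six pairs together with the third element. -/
def pairsA : List (Tri V) :=
  [.mk .e0 .e1 .e2, .mk .e1 .e0 .e2, .mk .e0 .e2 .e1, .mk .e2 .e0 .e1, .mk .e1 .e2 .e0, .mk .e2 .e1 .e0]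

/-- Success if some term in the list takes a value different from `e`. -/
noncomputable def chkNe (t : Tab) (a b c e : V) (l : List Tm) : TR :=
  List.rec (motive := fun _ => TR) .und
    (fun s _ k => ((s.peval t a b c).tst fun v =>
      Bool.rec (motive := fun _ => TR) .ok .und (v.eqb e)).or k) l

theorem chkNe_ok {t : Tab} {M : V → V → V → V} (hc : Compat t M) {a b c e : V} (l : List Tm)
    (h : chkNe t a b c e l = .ok) : ∃ s ∈ l, s.eval M a b c ≠ e := by
  induction l with
  | nil => simp [chkNe] at h
  | cons s l ih =>
    rcases TR.or_ok (s := chkNe t a b c e l) h with h | h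
    · obtain ⟨y, h1, h2⟩ := Res.tst_ok h
      refine ⟨s, by simp, ?_⟩
      rw [Tm.peval_sound hc s h1]
      rintro rfl
      simp [(V.eqb_iff y y).2 rfl] at h2
    · obtain ⟨w, hw, hh⟩ := ih h
      exact ⟨w, List.mem_cons_of_mem _ hw, hh⟩

noncomputable def chkPairs (t : Tab) (l : List (Tri V)) : TR :=
  List.rec (motive := fun _ => TR) .und
    (fun q _ k => Tri.rec (motive := fun _ => TR) (fun a b c =>
      (chkEq t (.ap .x .y .x) a b a c
        ((chkNe t b a b c wordsR).or (chkNe t a b a c wordsK))).or k) q) l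

theorem chkPairs_ok {t : Tab} {M : V → V → V → V} (hc : Compat t M)
    (l : List (Tri V)) (h : chkPairs t l = .ok) :
    ∃ a b c, Tri.mk a b c ∈ l ∧ M a b a = c ∧
      ((∃ s ∈ wordsR, s.eval M b a b ≠ c) ∨ (∃ s ∈ wordsK, s.eval M a b a ≠ c)) := by
  induction l with
  | nil => simp [chkPairs] at h
  | cons q l ih =>
    obtain ⟨a, b, c⟩ := q
    rcases TR.or_ok (s := chkPairs t l) h with h | h
    · obtain ⟨h1, h2⟩ := chkEq_ok hc h
      exact ⟨a, b, c, by simp, h1, (TR.or_ok h2).imp (chkNe_ok hc _) (chkNe_ok hc _)⟩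
    · obtain ⟨a', b', c', h1, h2⟩ := ih h
      exact ⟨a', b', c', List.mem_cons_of_mem _ h1, h2⟩

/-- The affine operation. -/
noncomputable def affV (a b c : V) : V :=
  b.sw (a.sw c (c.sw .e1 .e2 .e0) (c.sw .e2 .e0 .e1))
    (a.sw (c.sw .e2 .e0 .e1) c (c.sw .e1 .e2 .e0))
    (a.sw (c.sw .e1 .e2 .e0) (c.sw .e2 .e0 .e1) c)

noncomputable def testA (t : Tab) : TR :=
  (chkPairs t pairsA).or (chkAll t (.ap .x .y .z) affV allPts)

/-- The partial table of a Mal'cev operation. -/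
def tabA : Tab :=
  .mk (.mk (.mk (.v .e0) (.v .e1) (.v .e2)) (.mk .no (.v .e0) .no) (.mk .no .no (.v .e0)))
    (.mk (.mk (.v .e1) .no .no) (.mk (.v .e0) (.v .e1) (.v .e2)) (.mk .no .no (.v .e1)))
    (.mk (.mk (.v .e2) .no .no) (.mk .no (.v .e2) .no) (.mk (.v .e0) (.v .e1) (.v .e2)))

noncomputable def runA (a b c : V) : Bool := Tab.setK tabA a b a (.v c) (run testA 13)

theorem runA_ok1 : runA .e0 .e1 .e2 = true := by decide +kernel
theorem runA_ok2 : runA .e1 .e0 .e2 = true := by decide +kernel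
theorem runA_ok3 : runA .e0 .e2 .e1 = true := by decide +kernel
theorem runA_ok4 : runA .e2 .e0 .e1 = true := by decide +kernel
theorem runA_ok5 : runA .e1 .e2 .e0 = true := by decide +kernel
theorem runA_ok6 : runA .e2 .e1 .e0 = true := by decide +kernel

/-! ### Stage C -/

def termsC : List Tm :=
  [.ap (.ap .x .y .z) (.ap .y .z .x) (.ap .z .x .y),
   .ap .x (.ap .y .x (.ap .x .y .z)) (.ap .z .x (.ap .x .z .y)),
   .ap .x (.ap .x .z (.ap .x .y .z)) (.ap .x .y (.ap .x .z .y)),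
   .ap .y (.ap .x .z (.ap .x .y .z)) (.ap .x .y .z),
   .ap (.ap .x (.ap .x .y .z) .z) (.ap .z (.ap .x .y .z) .y) (.ap .y (.ap .x .y .z) .x),
   .ap .z (.ap .y (.ap .x .y .z) .x) (.ap .x .y .z),
   .ap (.ap .x .y (.ap .x .y .z)) (.ap .z .x (.ap .x .y .z)) (.ap .y .z (.ap .x .y .z)),
   .ap (.ap .x (.ap .x .y .z) .y) (.ap .x (.ap .x .z .y) .z) .x,
   .ap (.ap .y .z (.ap .x .z .y)) (.ap .y .z (.ap .x .y .z)) (.ap .y .x .z),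
   .ap (.ap (.ap .x .y .z) .y .z) (.ap (.ap .x .y .z) .x .y) (.ap (.ap .x .y .z) .x .z),
   .ap .x (.ap .z .x (.ap .x .y .z)) (.ap .y .x (.ap .x .z .y)),
   .ap (.ap .x .z (.ap .x .z .y)) (.ap .z .x .y) (.ap (.ap .x .y .z) .z .x),
   .ap (.ap .z .x .y) (.ap .x .y (.ap .x .z .y)) (.ap (.ap .x .y .z) .y .x),
   .ap (.ap .x (.ap .x .y .z) .z) (.ap .x .z .y) (.ap .y (.ap .x .y .z) (.ap .x .z .y)),
   .ap (.ap .x .y .z) (.ap .z .x .y) (.ap .y .z .x),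
   .ap (.ap .y .z (.ap .x .y .z)) (.ap (.ap .x .y .z) .x .y) (.ap (.ap .x .y .z) .z .x),
   .ap (.ap .y .z .x) (.ap (.ap .x .y .z) .x .z) (.ap .x (.ap .x .z .y) .z),
   .ap (.ap .x .z .y) .z (.ap .x .y (.ap .x .y .z)),
   .ap (.ap .x .z (.ap .x .y .z)) (.ap .y .z (.ap .x .y .z)) (.ap .x .y (.ap .x .y .z)),
   .ap (.ap .x (.ap .x .y .z) .y) (.ap .z (.ap .x .y .z) .y) (.ap .x .z (.ap .x .z .y)),
   .ap .z (.ap .z .y .x) (.ap .x (.ap .x .y .z) .y),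
   .ap (.ap (.ap .x .y .z) .z .y) (.ap .z .x .y) (.ap .y (.ap .x .y .z) .z),
   .ap (.ap .x .z .y) (.ap .z (.ap .x .y .z) .x) (.ap .x .z (.ap .x .z .y)),
   .ap .x (.ap .z .y .x) (.ap .y .z (.ap .x .y .z)),
   .ap (.ap .x .z (.ap .x .y .z)) .y (.ap .y .z .x),
   .ap (.ap .x (.ap .x .y .z) (.ap .x .z .y)) (.ap .y .x .z) (.ap .y .z (.ap .x .y .z)),
   .ap (.ap .x .z (.ap .x .y .z)) (.ap .x (.ap .x .y .z) .y) (.ap .y (.ap .x .y .z) .z),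
   .ap (.ap .x .z (.ap .x .z .y)) (.ap .x (.ap .x .z .y) .y) (.ap .y (.ap .x .y .z) .z),
   .ap (.ap .y .z .x) (.ap .x .z (.ap .x .z .y)) (.ap .z .x (.ap .x .y .z)),
   .ap (.ap .y .z (.ap .x .z .y)) (.ap .x .y .z) (.ap .z (.ap .x .y .z) .y),
   .ap (.ap .y (.ap .x .y .z) .z) (.ap .y .z .x) (.ap .y (.ap .x .z .y) .z),
   .ap (.ap .y .z .x) (.ap .x .z (.ap .x .y .z)) .y,
   .ap (.ap (.ap .x .y .z) .z .y) (.ap .y .z .x) (.ap .z .y (.ap .x .y .z)),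
   .ap (.ap .x .y (.ap .x .z .y)) (.ap .z .y (.ap .x .y .z)) (.ap .x .z (.ap .x .z .y)),
   .ap (.ap .x .z (.ap .x .y .z)) (.ap .y (.ap .x .y .z) (.ap .x .z .y)) (.ap .y .x .z),
   .ap (.ap .y .z .x) (.ap .x (.ap .x .y .z) .y) (.ap .y .x (.ap .x .y .z)),
   .ap (.ap .x .y (.ap .x .y .z)) (.ap .x .z .y) (.ap .x .y (.ap .x .z .y)),
   .ap (.ap .x (.ap .x .y .z) .y) (.ap .z .x .y) .z,
   .ap (.ap .x .z (.ap .x .z .y)) (.ap .y .z .x) (.ap .y (.ap .x .y .z) (.ap .x .z .y)),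
   .ap (.ap .x .y (.ap .x .z .y)) (.ap (.ap .x .y .z) .x .y) (.ap .y .z .x),
   .ap (.ap .z .x .y) (.ap .z (.ap .x .y .z) .x) (.ap .x .z (.ap .x .y .z)),
   .ap .z (.ap .y .x (.ap .x .y .z)) (.ap .x .y .z),
   .ap .x (.ap .y .x .z) (.ap .z .y (.ap .x .y .z)),
   .ap (.ap .y .z (.ap .x .y .z)) (.ap .x .y .z) .x,
   .ap (.ap .x .z (.ap .x .y .z)) .x (.ap .x .y (.ap .x .z .y)),
   .ap (.ap .x (.ap .x .y .z) (.ap .x .z .y)) (.ap .z (.ap .x .y .z) .y) (.ap .z .y .x),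
   .ap (.ap .y (.ap .x .y .z) .z) (.ap .z .y (.ap .x .z .y)) (.ap .x .z .y),
   .ap .y (.ap .x .z (.ap .x .y .z)) (.ap .z .x .y)]

noncomputable def dV (i a b c : V) : V :=
  Bool.rec (motive := fun _ => V)
    (Bool.rec (motive := fun _ => V)
      (Bool.rec (motive := fun _ => V) i a (b.eqb c)) b (a.eqb c)) c (a.eqb b)

noncomputable def chkD (t : Tab) (s : Tm) : TR :=
  (s.peval t .e0 .e1 .e2).tst fun i => chkAll t s (dV i) allPts

noncomputable def chkDs (t : Tab) (l : List Tm) : TR :=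
  List.rec (motive := fun _ => TR) .und (fun s _ k => (chkD t s).or k) l

/-- The cyclic shift. -/
noncomputable def V.sh (u : V) : V := u.sw .e1 .e2 .e0

/-- `m` is compatible with the cyclic shift on the orbit of `(0,1,2)`. -/
noncomputable def chkPhi (t : Tab) : TR :=
  (Tm.peval t .e0 .e1 .e2 (.ap .x .y .z)).tst fun u =>
    chkEq t (.ap .x .y .z) .e1 .e2 .e0 u.sh (chkEq t (.ap .x .y .z) .e2 .e0 .e1 u.sh.sh .ok)

noncomputable def testC (t : Tab) : TR := (chkPhi t).or (chkDs t termsC)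

/-- The partial table of a minority operation. -/
def tabC : Tab :=
  .mk (.mk (.mk (.v .e0) (.v .e1) (.v .e2)) (.mk (.v .e1) (.v .e0) .no) (.mk (.v .e2) .no (.v .e0)))
    (.mk (.mk (.v .e1) (.v .e0) .no) (.mk (.v .e0) (.v .e1) (.v .e2)) (.mk .no (.v .e2) (.v .e1)))
    (.mk (.mk (.v .e2) .no (.v .e0)) (.mk .no (.v .e2) (.v .e1)) (.mk (.v .e0) (.v .e1) (.v .e2)))

theorem runC_ok : run testC 7 tabC = true := by decide +kernel

/-! ### From the checker to operations on `Fin 3` -/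

def toF : V → Fin 3
  | .e0 => 0
  | .e1 => 1
  | .e2 => 2

def ofF : Fin 3 → V
  | 0 => .e0
  | 1 => .e1
  | 2 => .e2

theorem toF_ofF (a : Fin 3) : toF (ofF a) = a := by fin_cases a <;> rfl

theorem ofF_toF (a : V) : ofF (toF a) = a := by cases a <;> rfl

/-- The transferred operation. -/
def trV (m : Fin 3 → Fin 3 → Fin 3 → Fin 3) (u v w : V) : V := ofF (m (toF u) (toF v) (toF w))

theorem eval_trV (m : Fin 3 → Fin 3 → Fin 3 → Fin 3) (s : Tm) (a b c : V) :
    s.eval (trV m) a b c = ofF (s.eval m (toF a) (toF b) (toF c)) := by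
  induction s with
  | x => exact (ofF_toF _).symm
  | y => exact (ofF_toF _).symm
  | z => exact (ofF_toF _).symm
  | ap p q r hp hq hr => simp only [Tm.eval, hp, hq, hr, trV, toF_ofF]

theorem compat_tabA {M : V → V → V → V} (h1 : ∀ x y, M y x x = y) (h2 : ∀ x y, M x x y = y) :
    Compat tabA M := by
  intro u v w x h
  cases u <;> cases v <;> cases w <;> simp [tabA, Tab.look, Tri.get, V.sw] at h <;>
    subst h <;> first | exact h1 _ _ | exact h2 _ _

theorem compat_tabC {M : V → V → V → V} (h1 : ∀ x y, M y x x = y) (h2 : ∀ x y, M x x y = y)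
    (h3 : ∀ x y, M x y x = y) : Compat tabC M := by
  intro u v w x h
  cases u <;> cases v <;> cases w <;> simp [tabC, Tab.look, Tri.get, V.sw] at h <;>
    subst h <;> first | exact h1 _ _ | exact h2 _ _ | exact h3 _ _

theorem stageA_V {M : V → V → V → V} (h1 : ∀ x y, M y x x = y) (h2 : ∀ x y, M x x y = y)
    (hw : ∀ a b c, Tri.mk a b c ∈ pairsA → M a b a = c →
      (∀ s ∈ wordsR, s.eval M b a b = c) ∧ ∀ s ∈ wordsK, s.eval M a b a = c)
    {a b c : V} (hm : Tri.mk a b c ∈ pairsA) (hp : M a b a = c) (x y z : V) :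
    M x y z = affV x y z := by
  have hrun : run testA 13 (Tab.set tabA a b a (.v c)) = true := by
    rw [← Tab.setK_eq (k := run testA 13)]
    simp only [pairsA, List.mem_cons, List.not_mem_nil, or_false, Tri.mk.injEq] at hm
    rcases hm with ⟨rfl, rfl, rfl⟩ | ⟨rfl, rfl, rfl⟩ | ⟨rfl, rfl, rfl⟩ | ⟨rfl, rfl, rfl⟩ |
      ⟨rfl, rfl, rfl⟩ | ⟨rfl, rfl, rfl⟩
    · exact runA_ok1
    · exact runA_ok2
    · exact runA_ok3
    · exact runA_ok4
    · exact runA_ok5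
    · exact runA_ok6
  refine run_sound (M := M) ?_ _ _ ?_ hrun
  · intro t hc ht
    rcases TR.or_ok ht with ht | ht
    · obtain ⟨a, b, c, hq, hM, h⟩ := chkPairs_ok hc _ ht
      obtain ⟨g1, g2⟩ := hw a b c hq hM
      rcases h with ⟨s, hs, h⟩ | ⟨s, hs, h⟩
      · exact absurd (g1 s hs) h
      · exact absurd (g2 s hs) h
    · exact chkAll_ok hc _ ht x y z (mem_allPts _ _ _)
  · intro u v w x hx
    rw [Tab.look_set] at hx
    split_ifs at hx with e
    · obtain ⟨rfl, rfl, rfl⟩ := e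
      rw [hp]; exact E.v.inj hx
    · exact compat_tabA h1 h2 _ _ _ _ hx

/-- Mal'cev operations in curried form. -/
def Mal (m : Fin 3 → Fin 3 → Fin 3 → Fin 3) : Prop := ∀ x y, m y x x = y ∧ m x x y = y

def bad (m : Fin 3 → Fin 3 → Fin 3 → Fin 3) (a b : Fin 3) : Prop := a ≠ b ∧ m a b a = -(a + b)

theorem stageA {m : Fin 3 → Fin 3 → Fin 3 → Fin 3} (hm : Mal m)
    (hw : ∀ a b, bad m a b → (∀ s ∈ wordsR, s.eval m b a b = -(a + b)) ∧
      ∀ s ∈ wordsK, s.eval m a b a = -(a + b))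
    {a b : Fin 3} (hp : bad m a b) (x y z : Fin 3) : m x y z = x - y + z := by
  have key : ∀ a b c : V, Tri.mk a b c ∈ pairsA → toF a ≠ toF b ∧ c = ofF (-(toF a + toF b)) := by
    intro a b c h
    simp only [pairsA, List.mem_cons, List.not_mem_nil, or_false, Tri.mk.injEq] at h
    rcases h with ⟨rfl, rfl, rfl⟩ | ⟨rfl, rfl, rfl⟩ | ⟨rfl, rfl, rfl⟩ | ⟨rfl, rfl, rfl⟩ |
      ⟨rfl, rfl, rfl⟩ | ⟨rfl, rfl, rfl⟩ <;> exact ⟨by decide, rfl⟩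
  have key2 : ∀ a b : Fin 3, a ≠ b → Tri.mk (ofF a) (ofF b) (ofF (-(a + b))) ∈ pairsA := by
    intro a b h
    fin_cases a <;> fin_cases b <;> first | exact absurd rfl h | skip
    all_goals
      simp only [pairsA, List.mem_cons, List.not_mem_nil, or_false, Tri.mk.injEq]
      first
        | exact Or.inl ⟨rfl, rfl, rfl⟩
        | exact Or.inr (Or.inl ⟨rfl, rfl, rfl⟩)
        | exact Or.inr (Or.inr (Or.inl ⟨rfl, rfl, rfl⟩))
        | exact Or.inr (Or.inr (Or.inr (Or.inl ⟨rfl, rfl, rfl⟩)))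
        | exact Or.inr (Or.inr (Or.inr (Or.inr (Or.inl ⟨rfl, rfl, rfl⟩))))
        | exact Or.inr (Or.inr (Or.inr (Or.inr (Or.inr ⟨rfl, rfl, rfl⟩))))
  have haff : ∀ x y z : Fin 3, toF (affV (ofF x) (ofF y) (ofF z)) = x - y + z := by
    intro x y z
    fin_cases x <;> fin_cases y <;> fin_cases z <;> rfl
  have := stageA_V (M := trV m) (fun x y => by simp [trV, (hm _ _).1, ofF_toF])
    (fun x y => by simp [trV, (hm _ _).2, ofF_toF]) ?_ (key2 a b hp.1)
    (by simp [trV, toF_ofF, hp.2]) (ofF x) (ofF y) (ofF z)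
  · rw [← haff, ← this]; simp [trV, toF_ofF]
  · intro a b c h hM
    obtain ⟨h1, h2⟩ := key a b c h
    have hb : bad m (toF a) (toF b) := by
      refine ⟨h1, ?_⟩
      rw [h2] at hM
      have := congrArg toF hM
      simpa [trV, toF_ofF] using this
    obtain ⟨g1, g2⟩ := hw _ _ hb
    subst h2
    exact ⟨fun s hs => by rw [eval_trV, g1 s hs], fun s hs => by rw [eval_trV, g2 s hs]⟩

/-- `m` is a minority operation. -/
def Mino (m : Fin 3 → Fin 3 → Fin 3 → Fin 3) : Prop := Mal m ∧ ∀ x y, m x y x = y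

theorem dV_toF (i a b c : V) : toF (dV i a b c) = dOp (toF i) ![toF a, toF b, toF c] := by
  cases i <;> cases a <;> cases b <;> cases c <;> rfl

theorem chkDs_ok {t : Tab} {M : V → V → V → V} (hc : Compat t M) (l : List Tm)
    (h : chkDs t l = .ok) : ∃ (s : Tm) (i : V), ∀ a b c, s.eval M a b c = dV i a b c := by
  induction l with
  | nil => simp [chkDs] at h
  | cons s l ih =>
    rcases TR.or_ok (s := chkDs t l) h with h | h
    · obtain ⟨i, _, h2⟩ := Res.tst_ok h
      exact ⟨s, i, fun a b c => chkAll_ok hc _ h2 a b c (mem_allPts _ _ _)⟩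
    · exact ih h

theorem stageC {m : Fin 3 → Fin 3 → Fin 3 → Fin 3} (hm : Mino m) :
    (∃ (s : Tm) (i : Fin 3), ∀ a b c, s.eval m a b c = dOp i ![a, b, c]) ∨
      (m 1 2 0 = m 0 1 2 + 1 ∧ m 2 0 1 = m 0 1 2 + 2) := by
  refine run_sound (M := trV m) ?_ _ _ (compat_tabC ?_ ?_ ?_) runC_ok
  · intro t hc ht
    rcases TR.or_ok ht with ht | ht
    · right
      obtain ⟨u, h1, h2⟩ := Res.tst_ok ht
      have h1 := Tm.peval_sound hc _ h1
      obtain ⟨h2, h3⟩ := chkEq_ok hc h2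
      obtain ⟨h3, _⟩ := chkEq_ok hc h3
      simp only [Tm.eval, trV, toF] at h1 h2 h3
      have e1 : ∀ u : V, toF u.sh = toF u + 1 := by intro u; cases u <;> rfl
      have e2 : ∀ u : V, toF u.sh.sh = toF u + 2 := by intro u; cases u <;> rfl
      have g1 := congrArg toF h1
      have g2 := congrArg toF h2
      have g3 := congrArg toF h3
      rw [toF_ofF] at g1 g2 g3
      rw [g1, g2, g3]
      exact ⟨e1 u, e2 u⟩
    · left
      obtain ⟨s, i, h⟩ := chkDs_ok hc _ ht
      refine ⟨s, toF i, fun a b c => ?_⟩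
      have := congrArg toF (h (ofF a) (ofF b) (ofF c))
      rw [eval_trV, dV_toF] at this
      simpa [toF_ofF] using this
  · intro x y; simp [trV, (hm.1 _ _).1, ofF_toF]
  · intro x y; simp [trV, (hm.1 _ _).2, ofF_toF]
  · intro x y; simp [trV, hm.2, ofF_toF]

/-! ### Minimal bad sets -/

def opS (m : Fin 3 → Fin 3 → Fin 3 → Fin 3) (x y z : Fin 3) : Fin 3 :=
  m (m x z y) (m y z y) z

def opU (m : Fin 3 → Fin 3 → Fin 3 → Fin 3) (x y z : Fin 3) : Fin 3 :=
  m x (m x (m x y x) y) (m x (m x y x) z)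

theorem mal_S {m : Fin 3 → Fin 3 → Fin 3 → Fin 3} (hm : Mal m) : Mal (opS m) := by
  intro x y
  simp [opS, (hm _ _).1, (hm _ _).2]

theorem mal_U {m : Fin 3 → Fin 3 → Fin 3 → Fin 3} (hm : Mal m) : Mal (opU m) := by
  intro x y
  simp [opU, (hm _ _).1, (hm _ _).2]

theorem third (a b c : Fin 3) (hab : a ≠ b) (h1 : c ≠ a) (h2 : c ≠ b) : c = -(a + b) := by
  revert a b c; decide

theorem third_ne (a b : Fin 3) (hab : a ≠ b) : a ≠ -(a + b) ∧ b ≠ -(a + b) := by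
  revert a b; decide

theorem bad_S {m : Fin 3 → Fin 3 → Fin 3 → Fin 3} (hm : Mal m) {a b : Fin 3}
    (h : bad (opS m) a b) : bad m b a := by
  obtain ⟨hab, h⟩ := h
  obtain ⟨n1, n2⟩ := third_ne a b hab
  simp only [opS, (hm _ _).2] at h
  refine ⟨hab.symm, third b a _ hab.symm ?_ ?_⟩
  · intro e; rw [e, (hm _ _).2] at h; exact n1 h
  · intro e; rw [e, (hm _ _).1] at h; exact n2 h

theorem bad_U {m : Fin 3 → Fin 3 → Fin 3 → Fin 3} (hm : Mal m) {a b : Fin 3}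
    (h : bad (opU m) a b) : bad m a b := by
  obtain ⟨hab, h⟩ := h
  obtain ⟨n1, n2⟩ := third_ne a b hab
  simp only [opU] at h
  refine ⟨hab, third a b _ hab ?_ ?_⟩
  · intro e
    simp only [e, (hm _ _).2] at h; exact n1 h
  · intro e
    simp only [e, (hm _ _).2, (hm _ _).1] at h; exact n2 h

open Classical in
noncomputable def badSet (m : Fin 3 → Fin 3 → Fin 3 → Fin 3) : Finset (Fin 3 × Fin 3) :=
  Finset.univ.filter fun q => bad m q.1 q.2

theorem mem_badSet {m : Fin 3 → Fin 3 → Fin 3 → Fin 3} {a b : Fin 3} :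
    (a, b) ∈ badSet m ↔ bad m a b := by simp [badSet]

theorem card_badSet_le (m : Fin 3 → Fin 3 → Fin 3 → Fin 3) : (badSet m).card ≤ 6 := by
  have : badSet m ⊆ Finset.univ.filter fun q : Fin 3 × Fin 3 => q.1 ≠ q.2 := by
    rintro ⟨a, b⟩ h
    simpa using (mem_badSet.1 h).1
  exact (Finset.card_le_card this).trans (by decide)

theorem card_badSet_aff {m : Fin 3 → Fin 3 → Fin 3 → Fin 3} (h : ∀ x y z, m x y z = x - y + z) :
    (badSet m).card = 6 := by
  have : badSet m = Finset.univ.filter fun q : Fin 3 × Fin 3 => q.1 ≠ q.2 := by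
    ext ⟨a, b⟩
    rw [mem_badSet, bad, h]
    simp only [Finset.mem_filter, Finset.mem_univ, true_and]
    revert a b; decide
  rw [this]; decide

theorem keep_U {m : Fin 3 → Fin 3 → Fin 3 → Fin 3} (hm : Mal m)
    (hle : (badSet m).card ≤ (badSet (opU m)).card) :
    (badSet (opU m)).card = (badSet m).card ∧ ∀ a b, bad m a b → bad (opU m) a b := by
  have hs : badSet (opU m) ⊆ badSet m := by
    rintro ⟨a, b⟩ h
    exact mem_badSet.2 (bad_U hm (mem_badSet.1 h))
  have he := Finset.eq_of_subset_of_card_le hs hle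
  exact ⟨by rw [he], fun a b h => mem_badSet.1 (he ▸ mem_badSet.2 h)⟩

theorem keep_S {m : Fin 3 → Fin 3 → Fin 3 → Fin 3} (hm : Mal m)
    (hle : (badSet m).card ≤ (badSet (opS m)).card) :
    (badSet (opS m)).card = (badSet m).card ∧ ∀ a b, bad m a b → bad (opS m) b a := by
  have hs : (badSet (opS m)).image Prod.swap ⊆ badSet m := by
    intro q h
    obtain ⟨⟨a, b⟩, h1, rfl⟩ := Finset.mem_image.1 h
    exact mem_badSet.2 (bad_S hm (mem_badSet.1 h1))
  have hcard := Finset.card_image_of_injective (badSet (opS m)) Prod.swap_injective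
  have he := Finset.eq_of_subset_of_card_le hs (by rw [hcard]; exact hle)
  refine ⟨by rw [← he, hcard], fun a b h => ?_⟩
  have : (a, b) ∈ (badSet (opS m)).image Prod.swap := by rw [he]; exact mem_badSet.2 h
  obtain ⟨⟨a', b'⟩, h1, h2⟩ := Finset.mem_image.1 this
  simp only [Prod.swap_prod_mk, Prod.mk.injEq] at h2
  obtain ⟨rfl, rfl⟩ := h2
  exact mem_badSet.1 h1

/-- A minimal Mal'cev operation with a bad pair is affine. -/
theorem aff_of_min {D : (Fin 3 → Fin 3 → Fin 3 → Fin 3) → Prop} {N : ℕ}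
    (hS : ∀ m, D m → D (opS m)) (hU : ∀ m, D m → D (opU m))
    (hN : ∀ m, D m → Mal m → N ≤ (badSet m).card)
    {m : Fin 3 → Fin 3 → Fin 3 → Fin 3} (hD : D m) (hm : Mal m) (hc : (badSet m).card = N)
    {a b : Fin 3} (hab : bad m a b) (x y z : Fin 3) : m x y z = x - y + z := by
  have kS : ∀ m, D m → Mal m → (badSet m).card = N →
      (badSet (opS m)).card = N ∧ ∀ a b, bad m a b → bad (opS m) b a := by
    intro m hD hm hc
    have := keep_S hm (by rw [hc]; exact hN _ (hS _ hD) (mal_S hm))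
    rwa [hc] at this
  have kU : ∀ m, D m → Mal m → (badSet m).card = N →
      (badSet (opU m)).card = N ∧ ∀ a b, bad m a b → bad (opU m) a b := by
    intro m hD hm hc
    have := keep_U hm (by rw [hc]; exact hN _ (hU _ hD) (mal_U hm))
    rwa [hc] at this
  obtain ⟨cS, bS⟩ := kS m hD hm hc
  obtain ⟨cU, bU⟩ := kU m hD hm hc
  obtain ⟨-, bSS⟩ := kS _ (hS _ hD) (mal_S hm) cS
  obtain ⟨-, bUS⟩ := kU _ (hS _ hD) (mal_S hm) cS
  obtain ⟨-, bSU⟩ := kS _ (hU _ hD) (mal_U hm) cU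
  obtain ⟨-, bUU⟩ := kU _ (hU _ hD) (mal_U hm) cU
  refine stageA hm ?_ hab x y z
  intro a b h
  constructor
  · intro s hs
    simp only [wordsR, List.mem_cons, List.not_mem_nil, or_false] at hs
    rcases hs with rfl | rfl | rfl
    · rw [add_comm]; exact (bS _ _ h).2
    · rw [Tm.eval_subOp, add_comm]; exact (bUS _ _ (bS _ _ h)).2
    · rw [Tm.eval_subOp, add_comm]; exact (bSU _ _ (bU _ _ h)).2
  · intro s hs
    simp only [wordsK, List.mem_cons, List.not_mem_nil, or_false] at hs
    rcases hs with rfl | rfl | rfl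
    · exact (bU _ _ h).2
    · rw [Tm.eval_subOp]; exact (bSS _ _ (bS _ _ h)).2
    · rw [Tm.eval_subOp]; exact (bUU _ _ (bU _ _ h)).2

/-- Either there is a Mal'cev operation without bad pairs, or all of them are affine. -/
theorem dichotomy {D : (Fin 3 → Fin 3 → Fin 3 → Fin 3) → Prop}
    (hS : ∀ m, D m → D (opS m)) (hU : ∀ m, D m → D (opU m))
    (hex : ∃ m, D m ∧ Mal m) :
    (∃ m, D m ∧ Mal m ∧ ∀ a b, ¬ bad m a b) ∨
      ∀ m, D m → Mal m → ∀ x y z, m x y z = x - y + z := by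
  classical
  have hex' : ∃ n, ∃ m, D m ∧ Mal m ∧ (badSet m).card = n := by
    obtain ⟨m, h1, h2⟩ := hex
    exact ⟨_, m, h1, h2, rfl⟩
  obtain ⟨m, hD, hm, hc⟩ := Nat.find_spec hex'
  have hN : ∀ m, D m → Mal m → Nat.find hex' ≤ (badSet m).card :=
    fun m h1 h2 => Nat.find_min' hex' ⟨m, h1, h2, rfl⟩
  by_cases hb : ∀ a b, ¬ bad m a b
  · exact Or.inl ⟨m, hD, hm, hb⟩
  · right
    push Not at hb
    obtain ⟨a, b, hab⟩ := hb
    have haff := aff_of_min hS hU hN hD hm hc hab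
    have h6 : Nat.find hex' = 6 := by rw [← hc, card_badSet_aff haff]
    intro m' hD' hm'
    have hc' : (badSet m').card = Nat.find hex' :=
      le_antisymm (by rw [h6]; exact card_badSet_le m') (hN _ hD' hm')
    have hpos : (badSet m').Nonempty := by
      rw [← Finset.card_pos, hc', h6]; norm_num
    obtain ⟨⟨a', b'⟩, h'⟩ := hpos
    exact aff_of_min hS hU hN hD' hm' hc' (mem_badSet.1 h')

/-! ### Stage B -/

def opB (m : Fin 3 → Fin 3 → Fin 3 → Fin 3) (x y z : Fin 3) : Fin 3 :=
  m (m x y z) (m x z (m x y x)) (m x z y)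

theorem mino_B {m : Fin 3 → Fin 3 → Fin 3 → Fin 3} (hm : Mal m) (hb : ∀ a b, ¬ bad m a b) :
    Mino (opB m) := by
  have hp : ∀ x y, m x y x = x ∨ m x y x = y := by
    intro x y
    by_cases hxy : x = y
    · subst hxy; exact Or.inl (hm _ _).1
    · by_contra hh
      push Not at hh
      exact hb x y ⟨hxy, third x y _ hxy hh.1 hh.2⟩
  refine ⟨fun x y => ⟨?_, ?_⟩, fun x y => ?_⟩
  · simp only [opB, (hm _ _).1]
    rcases hp y x with h | h
    · rw [h, h, (hm _ _).2]
    · rw [h, (hm _ _).1, (hm _ _).2]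
  · simp only [opB, (hm _ _).2, (hm _ _).1]
  · simp only [opB, (hm _ _).2]

/-! ### The affine case -/

theorem affine_case {D : (Fin 3 → Fin 3 → Fin 3 → Fin 3) → Prop} {A : Fin 3 → Fin 3 → Fin 3 → Fin 3}
    (hA : D A) (hAm : Mal A)
    (hx : D fun x _ _ => x) (hy : D fun _ y _ => y) (hz : D fun _ _ z => z)
    (hcomp : ∀ f p q r, D f → D p → D q → D r → D fun x y z => f (p x y z) (q x y z) (r x y z))
    (hid : ∀ f, D f → ∀ a, f a a a = a)
    (haff : ∀ m, D m → Mal m → ∀ x y z, m x y z = x - y + z)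
    {f : Fin 3 → Fin 3 → Fin 3 → Fin 3} (hf : D f) : f 1 2 0 = f 0 1 2 + 1 := by
  have hAa := haff A hA hAm
  have E1 : ∀ g, D g → ∀ x y z, g x y z = g x y y + g y y z - y := by
    intro g hg x y z
    have hk : D fun x y z => A x (g x y y) (A (g x y z) (g y y z) z) :=
      hcomp _ _ _ _ hA hx (hcomp _ _ _ _ hg hx hy hy)
        (hcomp _ _ _ _ hA hg (hcomp _ _ _ _ hg hy hy hz) hz)
    have hkm : Mal fun x y z => A x (g x y y) (A (g x y z) (g y y z) z) := by
      intro x y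
      refine ⟨?_, ?_⟩
      · simp only [hid g hg, hAa]; generalize g y x x = t; revert x y t; decide
      · simp only [hid g hg, hAa]; generalize g x x y = t; revert x y t; decide
    have := haff _ hk hkm x y z
    simp only [hAa] at this
    generalize g x y z = p at *
    generalize g x y y = q at *
    generalize g y y z = r at *
    revert x y z p q r; decide
  have E2 : ∀ b : Fin 3 → Fin 3 → Fin 3, (D fun x y _ => b x y) →
      b 1 2 = b 0 1 + 1 ∧ b 2 0 = b 1 2 + 1 := by
    intro b hb
    have hb1 : D fun x _ z => b x z := hcomp _ _ _ _ hb hx hz hz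
    have hb2 : D fun x y z => b (A x y z) y := hcomp _ _ _ _ hb hA hy hy
    have i0 := hid _ hb 0
    have i1 := hid _ hb 1
    have i2 := hid _ hb 2
    have a1 := E1 _ hb1
    have a2 := E1 _ hb2
    simp only [hAa] at a2
    have p1 := a2 0 1 0
    have p2 := a1 1 2 1
    have p3 := a2 1 2 1
    have p4 := a1 2 0 2
    simp only [i1, i2, show (0 : Fin 3) - 1 + 0 = 2 from rfl, show (0 : Fin 3) - 1 + 1 = 0 from rfl,
      show (1 : Fin 3) - 1 + 0 = 0 from rfl, show (1 : Fin 3) - 2 + 1 = 0 from rfl,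
      show (1 : Fin 3) - 2 + 2 = 1 from rfl, show (2 : Fin 3) - 2 + 1 = 1 from rfl] at p1 p2 p3 p4
    clear a1 a2 i0 i1 i2
    generalize b 0 1 = c1 at *
    generalize b 1 2 = c2 at *
    generalize b 2 0 = c3 at *
    generalize b 2 1 = c4 at *
    generalize b 0 2 = c5 at *
    clear hb hb1 hb2
    revert c1 c2 c3 c4 c5; decide
  have g1 := E2 (fun x y => f x y y) (hcomp _ _ _ _ hf hx hy hy)
  have g2 := E2 (fun x y => f x x y) (hcomp _ _ _ _ hf hx hx hy)
  have q1 := E1 f hf 0 1 2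
  have q2 := E1 f hf 1 2 0
  rw [q1, q2, show f 1 2 2 = f 0 1 1 + 1 from g1.1, show f 2 2 0 = f 1 1 2 + 1 from g2.2]
  generalize f 0 1 1 = c1
  generalize f 1 1 2 = c2
  revert c1 c2; decide

/-- Every idempotent Mal'cev clone on `{0,1,2}` without a majority operation and with some
operation not preserving `φ` contains one of the operations `d₀, d₁, d₂`. -/
theorem stmt4 (C : Ops (Fin 3)) (hC : IsClone C)
    (hid : ∀ n, ∀ f ∈ C n, ∀ a : Fin 3, f (fun _ => a) = a)
    (hmal : ∃ m ∈ C 2, ∀ x y : Fin 3, m ![y, x, x] = y ∧ m ![x, x, y] = y)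
    (hnomaj : ¬ ∃ m ∈ C 2, ∀ x y : Fin 3,
      m ![x, x, y] = x ∧ m ![x, y, x] = x ∧ m ![y, x, x] = x)
    (hphi : ∃ n, ∃ f ∈ C n, ¬ Preserves f phi) :
    ∃ i : Fin 3, dOp i ∈ C 2 := by
  classical
  let D : (Fin 3 → Fin 3 → Fin 3 → Fin 3) → Prop := fun m => (fun x => m (x 0) (x 1) (x 2)) ∈ C 2
  have hx : D fun x _ _ => x := hC.proj 2 0
  have hy : D fun _ y _ => y := hC.proj 2 1
  have hz : D fun _ _ z => z := hC.proj 2 2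
  have hcomp : ∀ f p q r, D f → D p → D q → D r →
      D fun x y z => f (p x y z) (q x y z) (r x y z) := by
    intro f p q r hf hp hq hr
    refine hC.comp 2 2 (fun x => f (x 0) (x 1) (x 2)) ![fun x => p (x 0) (x 1) (x 2),
      fun x => q (x 0) (x 1) (x 2), fun x => r (x 0) (x 1) (x 2)] hf ?_
    intro i
    fin_cases i
    · exact hp
    · exact hq
    · exact hr
  have hidD : ∀ f, D f → ∀ a, f a a a = a := fun f hf a => hid 2 _ hf a
  have hvec : ∀ x : Fin 3 → Fin 3, ![x 0, x 1, x 2] = x := by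
    intro x; ext i; fin_cases i <;> rfl
  have hterm : ∀ (m) (s : Tm), D m → D fun a b c => s.eval m a b c := by
    intro m s hm
    induction s with
    | x => exact hx
    | y => exact hy
    | z => exact hz
    | ap p q r hp hq hr =>
      exact hcomp m (fun a b c => p.eval m a b c) (fun a b c => q.eval m a b c)
        (fun a b c => r.eval m a b c) hm hp hq hr
  have hS : ∀ m, D m → D (opS m) := fun m hm => hterm m tS hm
  have hU : ∀ m, D m → D (opU m) := fun m hm => hterm m tU hm
  have hex : ∃ m, D m ∧ Mal m := by
    obtain ⟨m, hm, h⟩ := hmal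
    refine ⟨fun x y z => m ![x, y, z], ?_, h⟩
    have : (fun x : Fin 3 → Fin 3 => m ![x 0, x 1, x 2]) = m := by
      funext x; rw [hvec]
    exact this.symm ▸ hm
  have hnon : ∃ f, D f ∧ f 1 2 0 ≠ f 0 1 2 + 1 := by
    have hmem : ∀ t, t ∈ phi ↔ t 1 = t 0 + 1 := by
      intro t
      simp only [phi, Set.mem_ofPred_eq, Set.mem_insert_iff, Set.mem_singleton_iff, Prod.mk.injEq]
      generalize t 0 = p
      generalize t 1 = q
      revert p q; decide
    obtain ⟨n, f, hf, hnp⟩ := hphi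
    simp only [Preserves, not_forall, hmem] at hnp
    obtain ⟨r, hr, hne⟩ := hnp
    refine ⟨fun x y z => f fun i => ![x, y, z] (r i 0), ?_, ?_⟩
    · have := hC.comp n 2 f (fun i x => x (r i 0)) hf fun i => hC.proj 2 (r i 0)
      have e : (fun x : Fin 3 → Fin 3 => f fun i => ![x 0, x 1, x 2] (r i 0))
          = fun x => f fun i => x (r i 0) := by
        funext x; rw [hvec]
      exact Set.mem_of_eq_of_mem e this
    · have e0 : ∀ a : Fin 3, ![(0 : Fin 3), 1, 2] a = a := by decide
      have e1 : ∀ a : Fin 3, ![(1 : Fin 3), 2, 0] a = a + 1 := by decide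
      simp only [e0, e1, ← hr]
      exact hne
  obtain ⟨f, hf, hfne⟩ := hnon
  have hfin : ∀ m, D m → (∃ (s : Tm) (i : Fin 3), ∀ a b c, s.eval m a b c = dOp i ![a, b, c]) →
      ∃ i : Fin 3, dOp i ∈ C 2 := by
    rintro m hm ⟨s, i, h⟩
    refine ⟨i, ?_⟩
    have h1 := hterm m s hm
    have e : (fun x : Fin 3 → Fin 3 => s.eval m (x 0) (x 1) (x 2)) = dOp i := by
      funext x; rw [h, hvec]
    exact e ▸ h1
  rcases dichotomy hS hU hex with ⟨m, hm, hmal', hb⟩ | haff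
  · have hB : D (opB m) :=
      hterm m (.ap (.ap .x .y .z) (.ap .x .z (.ap .x .y .x)) (.ap .x .z .y)) hm
    have hBm := mino_B hmal' hb
    generalize opB m = g at hB hBm
    rcases stageC hBm with h | ⟨h1, h2⟩
    · exact hfin g hB h
    · have hk : D fun x y z => f (g x y z) (g y z x) (g z x y) :=
        hcomp f g (fun x y z => g y z x) (fun x y z => g z x y) hf hB
          (hcomp g (fun _ y _ => y) (fun _ _ z => z) (fun x _ _ => x) hB hy hz hx)
          (hcomp g (fun _ _ z => z) (fun x _ _ => x) (fun _ y _ => y) hB hz hx hy)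
      have hkm : Mino fun x y z => f (g x y z) (g y z x) (g z x y) := by
        refine ⟨fun x y => ⟨?_, ?_⟩, fun x y => ?_⟩ <;>
          simp only [hBm.2, (hBm.1 _ _).1, (hBm.1 _ _).2, hidD f hf]
      rcases stageC hkm with h | ⟨h3, h4⟩
      · exact hfin _ hk h
      · exfalso
        simp only [h1, h2] at h3 h4
        generalize g 0 1 2 = u at h3 h4
        have hu : ∀ u : Fin 3, u = 0 ∨ u = 1 ∨ u = 2 := by decide
        apply hfne
        clear hk hkm
        rcases hu u with rfl | rfl | rfl
        · exact h3
        · change f 2 0 1 = f 1 2 0 + 1 at h3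
          change f 0 1 2 = f 1 2 0 + 2 at h4
          rw [h4]
          generalize f 1 2 0 = t
          revert t; decide
        · change f 0 1 2 = f 2 0 1 + 1 at h3
          change f 1 2 0 = f 2 0 1 + 2 at h4
          rw [h3, h4]
          generalize f 2 0 1 = t
          revert t; decide
  · obtain ⟨A, hA, hAm⟩ := hex
    exact absurd (affine_case hA hAm hx hy hz hcomp hidD haff hf) hfne
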